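/- Suppose f : ℝ → ℝ solves the safe-integration equation for (g₀, h₀, h₁). Then f is peaceful on the nonnegative reals: for every x ≥ 0, f(x) lies in the closed interval between f(⌊x⌋) and f(⌈x⌉) (where ⌊x⌋ and ⌈x⌉ denote the floor and ceiling of x). -/

import Mathlib

noncomputable def parity (x : ℝ) : ℝ := max 0 (Real.pi / 2 * Real.sin (Real.pi * x))

noncomputable def pfun (x : ℝ) : ℝ := ∫ t in (0:ℝ)..(x - 1), parity t

noncomputable def pfun' (x : ℝ) : ℝ := pfun (x - 1) + 1

def SolvesSafeIntegration (g0 : ℝ) (h0 h1 : ℝ → ℝ → ℝ) (f : ℝ → ℝ) : Prop :=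
  f 0 = g0 ∧ ∀ x : ℝ, HasDerivAt f
    (parity x * (h1 (pfun x) (f (pfun x)) - f (2 * pfun x)) +
     parity (x - 1) * (h0 (pfun' x) (f (pfun' x)) - f (2 * pfun' x - 1))) x

lemma parity_nonneg (x : ℝ) : 0 ≤ parity x := le_max_left _ _

lemma continuous_parity : Continuous parity := by
  unfold parity
  fun_prop

lemma parity_eq_zero_of_mem_Icc {m : ℤ} {x : ℝ} (hx : x ∈ Set.Icc (2 * m - 1 : ℝ) (2 * m)) :
    parity x = 0 := by
  have hsin : Real.sin (Real.pi * x) ≤ 0 := by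
    have h := Real.sin_nonpos_of_nonpos_of_neg_pi_le (x := Real.pi * x - m * (2 * Real.pi))
      (by nlinarith [Real.pi_pos, hx.2]) (by nlinarith [Real.pi_pos, hx.1])
    rwa [Real.sin_sub_int_mul_two_pi] at h
  exact max_eq_left (mul_nonpos_of_nonneg_of_nonpos (by positivity) hsin)

lemma pfun_eq_of_mem_Icc {m : ℤ} {x : ℝ} (hx : x ∈ Set.Icc (2 * m : ℝ) (2 * m + 1)) :
    pfun x = pfun (2 * m) := by
  have hzero : ∫ t in (2 * m - 1 : ℝ)..(x - 1), parity t = 0 := by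
    refine intervalIntegral.integral_zero_ae (Filter.Eventually.of_forall fun t ht => ?_)
    rw [Set.uIoc_of_le (by linarith [hx.1])] at ht
    exact parity_eq_zero_of_mem_Icc (m := m) ⟨ht.1.le, by linarith [ht.2, hx.2]⟩
  have hadd := intervalIntegral.integral_add_adjacent_intervals
    (continuous_parity.intervalIntegrable (μ := MeasureTheory.volume) 0 (2 * m - 1))
    (continuous_parity.intervalIntegrable (2 * m - 1) (x - 1))
  rw [hzero, add_zero] at hadd
  exact hadd.symm

lemma mem_uIcc_of_hasDerivAt_nonneg_mul {f g : ℝ → ℝ} {a b c : ℝ}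
    (hg : ∀ x, 0 ≤ g x) (hf : ∀ x ∈ Set.Icc a b, HasDerivAt f (g x * c) x)
    {x : ℝ} (hx : x ∈ Set.Icc a b) : f x ∈ Set.uIcc (f a) (f b) := by
  have hab : a ≤ b := hx.1.trans hx.2
  have hcont : ContinuousOn f (Set.Icc a b) := fun y hy => (hf y hy).continuousAt.continuousWithinAt
  have hderiv : ∀ y ∈ interior (Set.Icc a b),
      HasDerivWithinAt f (g y * c) (interior (Set.Icc a b)) y :=
    fun y hy => (hf y (interior_subset hy)).hasDerivWithinAt
  rw [Set.mem_uIcc]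
  rcases le_total 0 c with hc | hc
  · have hmono := monotoneOn_of_hasDerivWithinAt_nonneg (convex_Icc a b) hcont hderiv
      fun y _ => mul_nonneg (hg y) hc
    exact Or.inl ⟨hmono (Set.left_mem_Icc.2 hab) hx hx.1, hmono hx (Set.right_mem_Icc.2 hab) hx.2⟩
  · have hanti := antitoneOn_of_hasDerivWithinAt_nonpos (convex_Icc a b) hcont hderiv
      fun y _ => mul_nonpos_of_nonneg_of_nonpos (hg y) hc
    exact Or.inr ⟨hanti hx (Set.right_mem_Icc.2 hab) hx.2, hanti (Set.left_mem_Icc.2 hab) hx hx.1⟩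

lemma SolvesSafeIntegration.mem_uIcc {g0 : ℝ} {h0 h1 : ℝ → ℝ → ℝ} {f : ℝ → ℝ}
    (hf : SolvesSafeIntegration g0 h0 h1 f) (n : ℤ) {x : ℝ}
    (hx : x ∈ Set.Icc (n : ℝ) (n + 1)) : f x ∈ Set.uIcc (f n) (f (n + 1)) := by
  rcases Int.even_or_odd' n with ⟨m, rfl | rfl⟩
  · push_cast at hx ⊢
    refine mem_uIcc_of_hasDerivAt_nonneg_mul (g := parity)
      (c := h1 (pfun (2 * m)) (f (pfun (2 * m))) - f (2 * pfun (2 * m))) parity_nonneg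
      (fun y hy => ?_) hx
    have h := hf.2 y
    rwa [parity_eq_zero_of_mem_Icc (m := m) (x := y - 1)
        ⟨by linarith [hy.1], by linarith [hy.2]⟩,
      zero_mul, add_zero, pfun_eq_of_mem_Icc hy] at h
  · push_cast at hx ⊢
    refine mem_uIcc_of_hasDerivAt_nonneg_mul (g := fun y => parity (y - 1))
      (c := h0 (pfun (2 * m) + 1) (f (pfun (2 * m) + 1)) - f (2 * (pfun (2 * m) + 1) - 1))
      (fun y => parity_nonneg _) (fun y hy => ?_) hx
    have h := hf.2 y
    rwa [parity_eq_zero_of_mem_Icc (m := m + 1) (x := y)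
        ⟨by push_cast; linarith [hy.1], by push_cast; linarith [hy.2]⟩,
      zero_mul, zero_add, pfun', pfun_eq_of_mem_Icc (m := m) (x := y - 1)
        ⟨by linarith [hy.1], by linarith [hy.2]⟩] at h

theorem safe_integration_peaceful (g0 : ℝ) (h0 h1 : ℝ → ℝ → ℝ) (f : ℝ → ℝ)
    (hf : SolvesSafeIntegration g0 h0 h1 f) :
    ∀ x : ℝ, 0 ≤ x → f x ∈ Set.uIcc (f (⌊x⌋ : ℤ)) (f (⌈x⌉ : ℤ)) := by
  intro x _
  rcases (Int.floor_le x).eq_or_lt with hx | hx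
  · rw [hx]
    exact Set.left_mem_uIcc
  · have hceil : ⌈x⌉ = ⌊x⌋ + 1 := by
      rw [Int.ceil_eq_iff]
      push_cast
      exact ⟨by linarith, (Int.lt_floor_add_one x).le⟩
    rw [hceil, Int.cast_add, Int.cast_one]
    exact hf.mem_uIcc ⌊x⌋ ⟨hx.le, (Int.lt_floor_add_one x).le⟩
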